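/- Let K_1 ⊆ K_2 ⊆ ⋯ ⊆ K_n ⊆ F_q be subfields of F_q with |K_i| = d_i ≥ 2, X = K_1 × ⋯ × K_n, let δ ≥ 2 and s ∈ {1,…,n} with r := d_s − δ + 1 ≥ 1, and write d = ∑_{i=1}^k (d_i − 1) + ℓ with 0 ≤ k < n and 0 < ℓ ≤ d_{k+1} − 1. If W^(1)(D_X^{(δ,s)}(d)) = W^(1)(C_X(d)), then at least one of the following holds: (i) k + 2 ≤ n and d_{k+2} ≤ d_s; (ii) d_s ≤ d_{k+1} and 0 ≤ d_s − (d_{k+1} − ℓ) < r. -/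

import Mathlib

namespace QACC

open MvPolynomial

noncomputable section

variable {F : Type} [Field F] [Fintype F] [DecidableEq F]

/-- The points of the cartesian set `X = K 0 × ⋯ × K (n-1)`, as a subtype. -/
abbrev cartPoint {n : ℕ} (K : Fin n → Set F) : Type _ :=
  {α : Fin n → F // ∀ i, α i ∈ K i}

noncomputable instance {n : ℕ} (K : Fin n → Set F) : Fintype (cartPoint K) :=
  Fintype.ofFinite _

/-- The evaluation linear map `Ψ` sending a polynomial to its vector of values at points of X. -/
def evalX {n : ℕ} (K : Fin n → Set F) :
    MvPolynomial (Fin n) F →ₗ[F] (cartPoint K → F) where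
  toFun f := fun x => eval x.1 f
  map_add' f g := by funext x; simp
  map_smul' c f := by funext x; simp

/-- The affine cartesian code `C_X(d)`: evaluations of polynomials of total degree `≤ d`. -/
def cartCode {n : ℕ} (K : Fin n → Set F) (d : ℕ) : Submodule F (cartPoint K → F) :=
  (restrictTotalDegree (Fin n) F d).map (evalX K)

/-- The space `P_d^{(δ,s)}` of polynomials of total degree `≤ d` with degree in `X s`
at most `|K s| - δ`. -/
def quasiPoly (n : ℕ) (K : Fin n → Set F) (d δ : ℕ) (s : Fin n) :
    Submodule F (MvPolynomial (Fin n) F) where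
  carrier := {f | f.totalDegree ≤ d ∧ f.degreeOf s ≤ (K s).ncard - δ}
  zero_mem' := by simp
  add_mem' := by
    rintro f g ⟨hf1, hf2⟩ ⟨hg1, hg2⟩
    exact ⟨le_trans (totalDegree_add f g) (max_le hf1 hg1),
      le_trans (degreeOf_add_le s f g) (max_le hf2 hg2)⟩
  smul_mem' := by
    rintro c f ⟨hf1, hf2⟩
    refine ⟨le_trans (totalDegree_smul_le c f) hf1, ?_⟩
    calc (c • f).degreeOf s = (C c * f).degreeOf s := by rw [smul_eq_C_mul]
      _ ≤ (C c).degreeOf s + f.degreeOf s := degreeOf_mul_le s (C c) f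
      _ ≤ (K s).ncard - δ := by simpa [degreeOf_C] using hf2

/-- The `(δ,s)`-quasi affine cartesian code `D_X^{(δ,s)}(d)`. -/
def quasiCode {n : ℕ} (K : Fin n → Set F) (d δ : ℕ) (s : Fin n) :
    Submodule F (cartPoint K → F) :=
  (quasiPoly n K d δ s).map (evalX K)

/-- The minimum distance (minimum Hamming weight of a nonzero codeword) of a linear code. -/
def minDist {ι : Type} [Fintype ι] (C : Submodule F (ι → F)) : ℕ :=
  sInf {w | ∃ v ∈ C, v ≠ 0 ∧ hammingNorm v = w}


set_option linter.unusedSectionVars false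

open Finset in
/-- The footprint bound: a nonzero polynomial has a monomial `a` in its support such that the
number of points of a grid at which it does not vanish is at least `∏ (#(S i) - a i)`. -/
lemma exists_mem_support_prod_le_card_eval_ne_zero :
    ∀ {n : ℕ} {p : MvPolynomial (Fin n) F} (_ : p ≠ 0) (S : Fin n → Finset F),
      ∃ a ∈ p.support,
        ∏ i, (#(S i) - a i) ≤ #{x ∈ Fintype.piFinset S | eval x p ≠ 0}
  | 0, p, hp, S => by
    obtain ⟨a, ha⟩ := support_nonempty.2 hp
    refine ⟨a, ha, ?_⟩
    rw [p.eq_C_of_isEmpty] at *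
    simp [C_ne_zero.mp hp]
  | n + 1, p, hp, S => by
    set p' : Polynomial (MvPolynomial (Fin n) F) := finSuccEquiv F n p with hp'
    have hp'₀ : p' ≠ 0 := EmbeddingLike.map_ne_zero_iff.2 hp
    have hlead : p'.leadingCoeff ≠ 0 := by simpa
    obtain ⟨a, ha, hcard⟩ :=
      exists_mem_support_prod_le_card_eval_ne_zero hlead (fun i => S i.succ)
    refine ⟨a.cons p'.natDegree, mem_support_coeff_finSuccEquiv.1 ha, ?_⟩
    set T := {x ∈ Fintype.piFinset (fun i : Fin n => S i.succ) | eval x p'.leadingCoeff ≠ 0} with hT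
    have hfiber : ∀ y ∈ T, #(S 0) - p'.natDegree ≤
        #{c ∈ S 0 | eval (Fin.cons c y : Fin (n + 1) → F) p ≠ 0} := by
      intro y hy
      set q := p'.map (eval y) with hq
      have hlc : eval y p'.leadingCoeff ≠ 0 := (mem_filter.1 hy).2
      have hq₀ : q ≠ 0 := fun h => hlc <| by
        rw [Polynomial.leadingCoeff, ← Polynomial.coeff_map, ← hq, h, Polynomial.coeff_zero]
      have hroots : #{c ∈ S 0 | eval (Fin.cons c y : Fin (n + 1) → F) p = 0} ≤
          p'.natDegree := by
        calc
          _ ≤ #q.roots.toFinset := by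
            gcongr
            simp +contextual [subset_iff, eval_eq_eval_mv_eval', q, hq₀, p']
          _ ≤ Multiset.card q.roots := q.roots.toFinset_card_le
          _ ≤ q.natDegree := q.card_roots'
          _ ≤ p'.natDegree := Polynomial.natDegree_map_le
      have := card_filter_add_card_filter_not (s := S 0)
        (fun c => eval (Fin.cons c y : Fin (n + 1) → F) p = 0)
      simp only [ne_eq] at this ⊢
      omega
    calc
      ∏ i, (#(S i) - a.cons p'.natDegree i)
          = (∏ i : Fin n, (#(S i.succ) - a i)) * (#(S 0) - p'.natDegree) := by
        simp [Fin.prod_univ_succ, mul_comm]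
      _ ≤ #T * (#(S 0) - p'.natDegree) := by gcongr
      _ ≤ ∑ y ∈ T, #{c ∈ S 0 | eval (Fin.cons c y : Fin (n + 1) → F) p ≠ 0} := by
        rw [← smul_eq_mul]
        exact card_nsmul_le_sum _ _ _ hfiber
      _ = #(T.sigma fun y => {c ∈ S 0 | eval (Fin.cons c y : Fin (n + 1) → F) p ≠ 0}) :=
        (card_sigma _ _).symm
      _ ≤ _ := by
        refine card_le_card_of_injOn (fun z => (Fin.cons z.2 z.1 : Fin (n + 1) → F)) ?_ ?_
        · rintro ⟨y, c⟩ h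
          simp only [coe_sigma, Set.mem_sigma_iff, mem_coe, mem_filter, hT,
            Fintype.mem_piFinset] at h ⊢
          refine ⟨fun i => ?_, h.2.2⟩
          cases i using Fin.cases with
          | zero => simpa using h.2.1
          | succ i => simpa using h.1.1 i
        · rintro ⟨y, c⟩ - ⟨y', c'⟩ - h
          obtain ⟨rfl, rfl⟩ := Fin.cons_injective2 h
          rfl

/-- The Hamming weight of an evaluation vector counts the points where the polynomial does not
vanish. -/
lemma hammingNorm_evalX {n : ℕ} (K : Fin n → Set F) (S : Fin n → Finset F)
    (hS : ∀ i, (S i : Set F) = K i) (f : MvPolynomial (Fin n) F) :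
    hammingNorm (evalX K f) = (Finset.filter (fun x => eval x f ≠ 0)
      (Fintype.piFinset S)).card := by
  have hmem : ∀ i c, c ∈ S i ↔ c ∈ K i := fun i c => by rw [← hS i]; rfl
  rw [hammingNorm, ← Finset.card_map (Function.Embedding.subtype _)]
  congr 1
  ext x
  simp only [Finset.mem_map, Finset.mem_filter, Fintype.mem_piFinset, hmem]
  constructor
  · rintro ⟨y, hy, rfl⟩
    exact ⟨y.2, hy.2⟩
  · rintro ⟨hx, hfx⟩
    exact ⟨⟨x, hx⟩, ⟨Finset.mem_univ _, hfx⟩, rfl⟩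

/-- The exponent in `{0, …, q - 1}` defining the same power function as `a` on a field with `q`
elements. -/
def reduceExp (q a : ℕ) : ℕ := if a = 0 then 0 else (a - 1) % (q - 1) + 1

lemma reduceExp_le (q a : ℕ) : reduceExp q a ≤ a := by
  unfold reduceExp
  have := Nat.mod_le (a - 1) (q - 1)
  split_ifs <;> omega

lemma reduceExp_lt {q : ℕ} (hq : 2 ≤ q) (a : ℕ) : reduceExp q a < q := by
  unfold reduceExp
  have := Nat.mod_lt (a - 1) (show 0 < q - 1 by omega)
  split_ifs <;> omega

lemma pow_reduceExp {M : Type*} [Monoid M] {q : ℕ} (hq : 2 ≤ q) {x : M} (hx : x ^ q = x)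
    (a : ℕ) : x ^ reduceExp q a = x ^ a := by
  unfold reduceExp
  split_ifs with h
  · rw [h]
  have key : ∀ m r : ℕ, x ^ ((q - 1) * m + (r + 1)) = x ^ (r + 1) := by
    intro m r
    induction m with
    | zero => simp
    | succ m ih =>
      rw [← ih, show (q - 1) * (m + 1) + (r + 1) = (q - 1) * m + r + q by
        rw [mul_add]; omega, pow_add, hx, ← pow_succ, add_assoc]
  rw [← key ((a - 1) / (q - 1)) ((a - 1) % (q - 1)), ← add_assoc, Nat.div_add_mod]
  congr 1
  omega

/-- The exponent vector obtained by applying `reduceExp` in each variable. -/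
def reduceMonomial {n : ℕ} (q : Fin n → ℕ) (a : Fin n →₀ ℕ) : Fin n →₀ ℕ :=
  Finsupp.equivFunOnFinite.symm fun i => reduceExp (q i) (a i)

/-- The polynomial obtained by reducing all exponents. -/
def reducePoly {n : ℕ} (q : Fin n → ℕ) (f : MvPolynomial (Fin n) F) : MvPolynomial (Fin n) F :=
  ∑ a ∈ f.support, monomial (reduceMonomial q a) (coeff a f)

lemma eval_reducePoly {n : ℕ} {q : Fin n → ℕ} (hq : ∀ i, 2 ≤ q i) {x : Fin n → F}
    (hx : ∀ i, x i ^ q i = x i) (f : MvPolynomial (Fin n) F) :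
    eval x (reducePoly q f) = eval x f := by
  rw [reducePoly, map_sum, eval_eq']
  refine Finset.sum_congr rfl fun a _ => ?_
  rw [eval_monomial, Finsupp.prod_fintype _ _ (by simp)]
  congr 1
  exact Finset.prod_congr rfl fun i _ => pow_reduceExp (hq i) (hx i) (a i)

lemma exists_of_mem_support_reducePoly {n : ℕ} {q : Fin n → ℕ} {f : MvPolynomial (Fin n) F}
    {b : Fin n →₀ ℕ} (hb : b ∈ (reducePoly q f).support) :
    ∃ a ∈ f.support, ∀ i, b i = reduceExp (q i) (a i) := by
  obtain ⟨a, ha, hab⟩ := Finset.mem_biUnion.1 (support_sum hb)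
  refine ⟨a, ha, fun i => ?_⟩
  rw [Finset.mem_singleton.1 (support_monomial_subset hab)]
  rfl

lemma pow_ncard_of_mem (K : Subfield F) {x : F} (hx : x ∈ K) : x ^ (K : Set F).ncard = x := by
  have : Fintype K := Fintype.ofFinite _
  have h := FiniteField.pow_card (⟨x, hx⟩ : K)
  rw [← Nat.card_eq_fintype_card] at h
  rw [← Nat.card_coe_set_eq]
  exact congrArg Subtype.val h

/-- Every nonzero codeword of a quasi affine cartesian code over a product of subfields has weight
at least `∏ (d i - a i)` for some admissible reduced exponent vector `a`. -/
lemma exists_exponent_of_mem_quasiCode {n : ℕ} (K : Fin n → Subfield F)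
    (hK : ∀ i, 2 ≤ (K i : Set F).ncard) (d δ : ℕ) (s : Fin n)
    {v : cartPoint (fun i => (K i : Set F)) → F}
    (hv : v ∈ quasiCode (fun i => (K i : Set F)) d δ s) (hv₀ : v ≠ 0) :
    ∃ a : Fin n → ℕ, (∀ i, a i < (K i : Set F).ncard) ∧ ∑ i, a i ≤ d ∧
      a s ≤ (K s : Set F).ncard - δ ∧
      ∏ i, ((K i : Set F).ncard - a i) ≤ hammingNorm v := by
  obtain ⟨f, ⟨hfd, hfs⟩, rfl⟩ := hv
  set q : Fin n → ℕ := fun i => (K i : Set F).ncard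
  set g := reducePoly q f
  have hfg : evalX (fun i => (K i : Set F)) g = evalX (fun i => (K i : Set F)) f := by
    funext x
    exact eval_reducePoly hK (fun i => pow_ncard_of_mem (K i) (x.2 i)) f
  have hg : g ≠ 0 := by
    intro h
    rw [← hfg, h, map_zero] at hv₀
    exact hv₀ rfl
  let S : Fin n → Finset F := fun i => (K i : Set F).toFinite.toFinset
  obtain ⟨b, hb, hcard⟩ := exists_mem_support_prod_le_card_eval_ne_zero hg S
  obtain ⟨a, ha, hab⟩ := exists_of_mem_support_reducePoly hb
  have hba : ∀ i, b i ≤ a i := fun i => (hab i).trans_le (reduceExp_le _ _)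
  refine ⟨b, fun i => (hab i).trans_lt (reduceExp_lt (hK i) _), ?_, ?_, ?_⟩
  · calc
      ∑ i, b i ≤ ∑ i, a i := Finset.sum_le_sum fun i _ => hba i
      _ = a.sum fun _ e => e := (Finsupp.sum_fintype a (fun _ e => e) fun _ => rfl).symm
      _ ≤ f.totalDegree := le_totalDegree ha
      _ ≤ d := hfd
  · exact (hba s).trans ((monomial_le_degreeOf s ha).trans hfs)
  · rw [← hfg, hammingNorm_evalX (fun i => (K i : Set F)) S (fun i => by simp [S])]
    simpa [S, Set.ncard_eq_toFinset_card _ (Set.toFinite _)] using hcard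

/-- Products of linear factors give codewords of prescribed weight in `C_X(d)`. -/
lemma exists_mem_cartCode {n : ℕ} (K : Fin n → Set F) {d : ℕ} (e : Fin n → ℕ)
    (he : ∀ i, e i < (K i).ncard) (hd : ∑ i, e i ≤ d) :
    ∃ v ∈ cartCode K d, v ≠ 0 ∧ hammingNorm v = ∏ i, ((K i).ncard - e i) := by
  let S : Fin n → Finset F := fun i => (K i).toFinite.toFinset
  have hS : ∀ i, (S i).card = (K i).ncard := fun i =>
    (Set.ncard_eq_toFinset_card _ (Set.toFinite _)).symm
  have hA : ∀ i, ∃ A ⊆ S i, A.card = e i := fun i =>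
    Finset.exists_subset_card_eq (by rw [hS]; exact (he i).le)
  choose A hAS hAe using hA
  set f : MvPolynomial (Fin n) F := ∏ i, ∏ c ∈ A i, (X i - C c) with hf
  have hfd : f.totalDegree ≤ d := by
    refine (totalDegree_finsetProd _ _).trans (le_trans ?_ hd)
    refine Finset.sum_le_sum fun i _ => (totalDegree_finsetProd _ _).trans ?_
    rw [← hAe i, Finset.card_eq_sum_ones]
    exact Finset.sum_le_sum fun c _ => (totalDegree_sub_C_le _ _).trans (totalDegree_X i).le
  have hw : hammingNorm (evalX K f) = ∏ i, ((K i).ncard - e i) := by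
    rw [hammingNorm_evalX K S (fun i => by simp [S])]
    have : Finset.filter (fun x => eval x f ≠ 0) (Fintype.piFinset S) =
        Fintype.piFinset fun i => S i \ A i := by
      ext x
      simp only [Finset.mem_filter, Fintype.mem_piFinset, Finset.mem_sdiff, hf, map_prod,
        Finset.prod_ne_zero_iff, Finset.mem_univ, true_imp_iff, map_sub, eval_X, eval_C,
        sub_ne_zero, ← forall_and]
      refine forall_congr' fun i => and_congr_right fun _ => ?_
      exact ⟨fun h hx => h _ hx rfl, fun h c hc hxc => h (hxc ▸ hc)⟩
    rw [this, Fintype.card_piFinset]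
    exact Finset.prod_congr rfl fun i _ => by
      rw [Finset.card_sdiff_of_subset (hAS i), hS, hAe]
  refine ⟨evalX K f, ⟨f, (mem_restrictTotalDegree _ _ _).2 hfd, rfl⟩, fun h => ?_, hw⟩
  rw [h, hammingNorm_zero] at hw
  exact (Finset.prod_pos fun i _ => Nat.sub_pos_of_lt (he i)).ne hw

lemma sum_add_one_le_prod_add_card {ι : Type*} (L : Finset ι) (y : ι → ℕ)
    (hy : ∀ i ∈ L, 1 ≤ y i) : ∑ i ∈ L, y i + 1 ≤ ∏ i ∈ L, y i + L.card := by
  classical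
  induction L using Finset.induction_on with
  | empty => simp
  | insert i L hi ih =>
    rw [Finset.sum_insert hi, Finset.prod_insert hi, Finset.card_insert_of_notMem hi]
    have h1 := ih fun j hj => hy j (Finset.mem_insert_of_mem hj)
    have h2 : 0 < ∏ j ∈ L, y j :=
      Finset.prod_pos fun j hj => hy j (Finset.mem_insert_of_mem hj)
    have h3 := hy i (Finset.mem_insert_self _ _)
    obtain ⟨u, hu⟩ : ∃ u, y i = u + 1 := ⟨y i - 1, by omega⟩
    obtain ⟨w, hw⟩ : ∃ w, ∏ j ∈ L, y j = w + 1 := ⟨∏ j ∈ L, y j - 1, by omega⟩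
    rw [hw] at h1 ⊢
    rw [hu]
    nlinarith [Nat.zero_le (u * w)]

/-- Among vectors with bounded entries and large sum, the product is minimal when the entries with
the largest bounds are maximal. -/
lemma mul_prod_le_prod_mul_prod {ι : Type*} (L T : Finset ι) (D : ι → ℕ) (m t : ℕ)
    (hD : ∀ j ∈ T, m ≤ D j) (E : ℕ) : ∀ y x : ι → ℕ, (∀ i ∈ L, 1 ≤ y i ∧ y i ≤ m) →
      (∀ j ∈ T, 1 ≤ x j ∧ x j ≤ D j) → ∑ j ∈ T, x j + E = ∑ j ∈ T, D j →
      L.card + E + t ≤ ∑ i ∈ L, y i + 1 →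
      t * ∏ j ∈ T, D j ≤ (∏ i ∈ L, y i) * ∏ j ∈ T, x j := by
  classical
  induction E using Nat.strong_induction_on with
  | _ E ih =>
  intro y x hy hx hE hL
  rcases Nat.eq_zero_or_pos t with rfl | ht
  · simp
  rcases Nat.eq_zero_or_pos E with rfl | hE₀
  · have hxD := (Finset.sum_eq_sum_iff_of_le fun j hj => (hx j hj).2).1 hE
    rw [Finset.prod_congr rfl hxD]
    have := sum_add_one_le_prod_add_card L y fun i hi => (hy i hi).1
    exact Nat.mul_le_mul_right _ (by omega)
  obtain ⟨j, hj, hxj⟩ : ∃ j ∈ T, x j < D j := by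
    by_contra! h
    have := Finset.sum_le_sum h
    omega
  obtain ⟨i, hi, hyi⟩ : ∃ i ∈ L, 1 < y i := by
    by_contra! h
    have := Finset.sum_le_sum h
    simp at this
    omega
  obtain ⟨z, w, hzw, hxz, hw, hzD, hwy, hle⟩ : ∃ z w, w + z = y i + x j ∧ x j < z ∧ 1 ≤ w ∧
      z ≤ D j ∧ w ≤ y i ∧ w * z ≤ y i * x j := by
    have := hD j hj
    have := hy i hi
    have := hx j hj
    rcases le_or_gt (y i) (x j) with h | h
    · refine ⟨x j + 1, y i - 1, by omega, by omega, by omega, by omega, by omega, ?_⟩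
      obtain ⟨u, hu⟩ : ∃ u, y i = u + 1 := ⟨y i - 1, by omega⟩
      rw [hu] at h ⊢
      simp only [Nat.add_sub_cancel]
      nlinarith
    · exact ⟨y i, x j, by omega, by omega, by omega, by omega, by omega, (mul_comm _ _).le⟩
  have hsx := Finset.add_sum_erase T x hj
  have hsy := Finset.add_sum_erase L y hi
  have hux : ∑ a ∈ T, Function.update x j z a = z + ∑ a ∈ T.erase j, x a := by
    rw [Finset.sum_update_of_mem hj, Finset.sdiff_singleton_eq_erase]
  have huy : ∑ a ∈ L, Function.update y i w a = w + ∑ a ∈ L.erase i, y a := by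
    rw [Finset.sum_update_of_mem hi, Finset.sdiff_singleton_eq_erase]
  have hle' : ∑ a ∈ T, Function.update x j z a ≤ ∑ a ∈ T, D a := by
    refine Finset.sum_le_sum fun a ha => ?_
    rw [Function.update_apply]
    split_ifs with h
    · exact h ▸ hzD
    · exact (hx a ha).2
  refine (ih (E - (z - x j)) (by omega) (Function.update y i w) (Function.update x j z)
    ?_ ?_ (by omega) (by omega)).trans ?_
  · intro a ha
    rw [Function.update_apply]
    split_ifs with h
    · exact ⟨hw, hwy.trans (hy i hi).2⟩
    · exact hy a ha
  · intro a ha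
    rw [Function.update_apply]
    split_ifs with h
    · exact ⟨by omega, h ▸ hzD⟩
    · exact hx a ha
  · rw [Finset.prod_update_of_mem hj, Finset.prod_update_of_mem hi,
      Finset.sdiff_singleton_eq_erase, Finset.sdiff_singleton_eq_erase,
      ← Finset.mul_prod_erase T x hj, ← Finset.mul_prod_erase L y hi, mul_mul_mul_comm,
      mul_mul_mul_comm (y i)]
    exact Nat.mul_le_mul_right _ hle

/-- A strict form of the minimality of `t * ∏_{i > k} D i`: it is not attained when some entry
`b s` with `s ≤ k` differs from `1`, from `t` and from the bounds `D i` with `i > k`. -/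
lemma mul_prod_lt_prod {n : ℕ} (D b : Fin n → ℕ) (hD : Monotone D) (k s : Fin n) (t : ℕ)
    (hb : ∀ i, 1 ≤ b i ∧ b i ≤ D i) (hsk : s ≤ k) (hDs : ∀ i, k < i → D s < D i)
    (hbs : 2 ≤ b s) (hne : b s ≠ t)
    (hsum : (k : ℕ) + t + ∑ i ∈ Finset.Ioi k, D i ≤ ∑ i, b i) :
    t * ∏ i ∈ Finset.Ioi k, D i < ∏ i, b i := by
  set L := (Finset.Iic k).erase s with hL
  have hsL : s ∈ Finset.Iic k := Finset.mem_Iic.2 hsk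
  have hcard : L.card = k := by
    rw [hL, Finset.card_erase_of_mem hsL, Fin.card_Iic]
    rfl
  have hdisj : Disjoint (Finset.Iic k) (Finset.Ioi k) := by
    rw [Finset.disjoint_left]
    intro i hi hi'
    exact absurd (Finset.mem_Ioi.1 hi') (not_lt.2 (Finset.mem_Iic.1 hi))
  have huniv : (Finset.univ : Finset (Fin n)) = Finset.Iic k ∪ Finset.Ioi k := by
    ext i
    simp [le_or_gt]
  rw [huniv, Finset.sum_union hdisj, ← Finset.add_sum_erase _ b hsL, ← hL] at hsum
  rw [huniv, Finset.prod_union hdisj, ← Finset.mul_prod_erase _ b hsL, ← hL]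
  have hLk : ∀ i ∈ L, i ≤ k := fun i hi => Finset.mem_Iic.1 (Finset.mem_of_mem_erase hi)
  have hTle := Finset.sum_le_sum fun i (_ : i ∈ Finset.Ioi k) => (hb i).2
  have hTpos : 0 < ∏ i ∈ Finset.Ioi k, D i :=
    Finset.prod_pos fun i _ => (hb i).1.trans (hb i).2
  rcases lt_or_gt_of_ne hne with hlt | hgt
  · have key := mul_prod_le_prod_mul_prod L (Finset.Ioi k) D (D k) (t - b s + 1)
      (fun j hj => hD (Finset.mem_Ioi.1 hj).le)
      (∑ i ∈ Finset.Ioi k, D i - ∑ i ∈ Finset.Ioi k, b i) b b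
      (fun i hi => ⟨(hb i).1, (hb i).2.trans (hD (hLk i hi))⟩) (fun i _ => hb i)
      (by omega) (by omega)
    have hstep : t < b s * (t - b s + 1) := by
      obtain ⟨u, rfl⟩ : ∃ u, t = b s + u := ⟨t - b s, by omega⟩
      rw [Nat.add_sub_cancel_left]
      nlinarith
    calc
      _ < b s * (t - b s + 1) * ∏ i ∈ Finset.Ioi k, D i := Nat.mul_lt_mul_of_pos_right hstep hTpos
      _ ≤ b s * ((∏ i ∈ L, b i) * ∏ i ∈ Finset.Ioi k, b i) := by
        rw [mul_assoc]
        exact Nat.mul_le_mul_left _ key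
      _ = _ := by rw [mul_assoc]
  · rcases Finset.eq_empty_or_nonempty (Finset.Ioi k) with hT | hT
    · have : 0 < ∏ i ∈ L, b i := Finset.prod_pos fun i _ => (hb i).1
      rw [hT, Finset.prod_empty, Finset.prod_empty]
      nlinarith
    set j := (Finset.Ioi k).min' hT with hj
    have hjT : j ∈ Finset.Ioi k := Finset.min'_mem _ _
    have hkj : k < j := Finset.mem_Ioi.1 hjT
    set T := (Finset.Ioi k).erase j with hTdef
    have hjL : j ∉ L := fun h => absurd (hLk j h) (not_le.2 hkj)
    have hjle : ∀ i ∈ T, j ≤ i := fun i hi =>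
      Finset.min'_le _ _ (Finset.mem_of_mem_erase hi)
    have hDj := hDs j hkj
    have hbsD := (hb s).2
    have hsb := Finset.add_sum_erase _ b hjT
    have hsD := Finset.add_sum_erase _ D hjT
    rw [← hTdef] at hsb hsD
    have hTle' := Finset.sum_le_sum fun i (_ : i ∈ T) => (hb i).2
    have key := mul_prod_le_prod_mul_prod (insert j L) T D (D j) (D j - (b s - t))
      (fun i hi => hD (hjle i hi)) (∑ i ∈ T, D i - ∑ i ∈ T, b i) b b
      (fun i hi => ⟨(hb i).1, (hb i).2.trans (hD (by
        rcases Finset.mem_insert.1 hi with rfl | h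
        · exact le_rfl
        · exact (hLk i h).trans hkj.le))⟩) (fun i _ => hb i)
      (by omega) (by
        rw [Finset.card_insert_of_notMem hjL, Finset.sum_insert hjL]
        omega)
    have hstep : t * D j < b s * (D j - (b s - t)) := by
      obtain ⟨u, hu⟩ : ∃ u, b s = t + u := ⟨b s - t, by omega⟩
      obtain ⟨w, hw⟩ : ∃ w, D j = b s + w := ⟨D j - b s, by omega⟩
      rw [hw, hu, Nat.add_sub_cancel_left, show t + u + w - u = t + w by omega]
      have : 0 < u * w := Nat.mul_pos (by omega) (by omega)
      nlinarith
    have hTpos' : 0 < ∏ i ∈ T, D i := Finset.prod_pos fun i _ => (hb i).1.trans (hb i).2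
    rw [← Finset.mul_prod_erase _ b hjT, ← Finset.mul_prod_erase _ D hjT, ← hTdef]
    rw [Finset.prod_insert hjL] at key
    calc
      t * (D j * ∏ i ∈ T, D i) = t * D j * ∏ i ∈ T, D i := by ring
      _ < b s * (D j - (b s - t)) * ∏ i ∈ T, D i := Nat.mul_lt_mul_of_pos_right hstep hTpos'
      _ ≤ b s * ((b j * ∏ i ∈ L, b i) * ∏ i ∈ T, b i) := by
        rw [mul_assoc]
        exact Nat.mul_le_mul_left _ key
      _ = _ := by ring

/-- The minimum distance of a code containing a nonzero word is attained. -/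
lemma exists_hammingNorm_eq_minDist {ι : Type} [Fintype ι] {C : Submodule F (ι → F)}
    (hC : ∃ v ∈ C, v ≠ 0) : ∃ v ∈ C, v ≠ 0 ∧ hammingNorm v = minDist C := by
  obtain ⟨v, hv, hv₀⟩ := hC
  exact Nat.sInf_mem (s := {w | ∃ v ∈ C, v ≠ 0 ∧ hammingNorm v = w}) ⟨_, v, hv, hv₀, rfl⟩

lemma minDist_le {ι : Type} [Fintype ι] {C : Submodule F (ι → F)} {v : ι → F} (hv : v ∈ C)
    (hv₀ : v ≠ 0) : minDist C ≤ hammingNorm v :=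
  Nat.sInf_le (s := {w | ∃ v ∈ C, v ≠ 0 ∧ hammingNorm v = w}) ⟨v, hv, hv₀, rfl⟩

lemma exists_ne_zero_mem_quasiCode {n : ℕ} (K : Fin n → Set F) (hK : ∀ i, (K i).Nonempty)
    (d δ : ℕ) (s : Fin n) : ∃ v ∈ quasiCode K d δ s, v ≠ 0 := by
  choose x hx using hK
  refine ⟨evalX K 1, ⟨1, ⟨by simp, by simp⟩, rfl⟩, fun h => ?_⟩
  simpa [evalX] using congrFun h ⟨x, hx⟩

/-- for a chain of subfields, if W¹(D_X^{(δ,s)}(d)) = W¹(C_X(d)) then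
(i) k + 2 ≤ n and d_{k+2} ≤ d_s, or (ii) d_s ≤ d_{k+1} and 0 ≤ d_s - (d_{k+1} - ℓ) < r.
(0-based indices; the condition d_s - (d_{k+1} - ℓ) ≥ 0 is expressed as
d_{k+1} - ℓ ≤ d_s.) -/
theorem minDist_eq_implies_conditions
    (n : ℕ) (K : Fin n → Subfield F) (hmono : Monotone K)
    (hK : ∀ i, 2 ≤ ((K i : Set F)).ncard)
    (δ : ℕ) (hδ : 2 ≤ δ) (s : Fin n) (hδs : δ ≤ ((K s : Set F)).ncard)
    (r : ℕ) (hrdef : r = ((K s : Set F)).ncard - δ + 1)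
    (d k ℓ : ℕ) (hk : k < n)
    (hd : d = (∑ i ∈ Finset.univ.filter (fun i : Fin n => (i : ℕ) < k),
        (((K i : Set F)).ncard - 1)) + ℓ)
    (hℓ1 : 0 < ℓ) (hℓ2 : ℓ ≤ ((K ⟨k, hk⟩ : Set F)).ncard - 1)
    (hmin : minDist (quasiCode (fun i => (K i : Set F)) d δ s) =
        minDist (cartCode (fun i => (K i : Set F)) d)) :
    (∃ hk2 : k + 1 < n, ((K ⟨k + 1, hk2⟩ : Set F)).ncard ≤ ((K s : Set F)).ncard) ∨
    (((K s : Set F)).ncard ≤ ((K ⟨k, hk⟩ : Set F)).ncard ∧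
      ((K ⟨k, hk⟩ : Set F)).ncard - ℓ ≤ ((K s : Set F)).ncard ∧
      ((K s : Set F)).ncard - (((K ⟨k, hk⟩ : Set F)).ncard - ℓ) < r) := by
  by_contra hcon
  push Not at hcon
  obtain ⟨hc1, hc2⟩ := hcon
  set D : Fin n → ℕ := fun i => (K i : Set F).ncard with hDdef
  have hD : Monotone D := fun i j hij => Set.ncard_le_ncard (hmono hij) (Set.toFinite _)
  set k' : Fin n := ⟨k, hk⟩ with hk'
  have hℓ : ℓ ≤ D k' - 1 := hℓ2
  have hDk : 2 ≤ D k' := hK k'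
  have hDs : ∀ i, k' < i → D s < D i := by
    intro i hi
    have hki : k < (i : ℕ) := hi
    have hk2 : k + 1 < n := by omega
    exact (hc1 hk2).trans_le (hD (show (⟨k + 1, hk2⟩ : Fin n) ≤ i from hki))
  have hsk : s ≤ k' := by
    by_contra h
    exact lt_irrefl _ (hDs s (not_le.1 h))
  have hfilter : (Finset.univ.filter fun i : Fin n => (i : ℕ) < k) = Finset.Iio k' := by
    ext i
    simp [Fin.lt_def, hk']
  rw [hfilter] at hd
  have hsplit : ∀ g : Fin n → ℕ, ∑ i, g i =
      ∑ i ∈ Finset.Iio k', g i + (g k' + ∑ i ∈ Finset.Ioi k', g i) := by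
    intro g
    rw [← Finset.sum_insert Finset.notMem_Ioi_self, Finset.Ioi_insert, ← Finset.sum_union]
    · congr 1
      ext i
      simp [lt_or_ge]
    · rw [Finset.disjoint_left]
      intro i hi hi'
      exact absurd (Finset.mem_Iio.1 hi) (not_lt.2 (Finset.mem_Ici.1 hi'))
  have hsplit' : ∀ g : Fin n → ℕ, ∏ i, g i =
      (∏ i ∈ Finset.Iio k', g i) * (g k' * ∏ i ∈ Finset.Ioi k', g i) := by
    intro g
    rw [← Finset.prod_insert Finset.notMem_Ioi_self, Finset.Ioi_insert, ← Finset.prod_union]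
    · congr 1
      ext i
      simp [lt_or_ge]
    · rw [Finset.disjoint_left]
      intro i hi hi'
      exact absurd (Finset.mem_Iio.1 hi) (not_lt.2 (Finset.mem_Ici.1 hi'))
  have hupper : minDist (cartCode (fun i => (K i : Set F)) d) ≤
      (D k' - ℓ) * ∏ i ∈ Finset.Ioi k', D i := by
    let e : Fin n → ℕ := fun i => if i < k' then D i - 1 else if i = k' then ℓ else 0
    have he1 : ∀ i ∈ Finset.Iio k', e i = D i - 1 := fun i hi => if_pos (Finset.mem_Iio.1 hi)
    have he2 : e k' = ℓ := by simp [e]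
    have he3 : ∀ i ∈ Finset.Ioi k', e i = 0 := fun i hi => by
      have := Finset.mem_Ioi.1 hi
      simp [e, this.not_gt, this.ne']
    obtain ⟨v, hv, hv₀, hw⟩ := exists_mem_cartCode (fun i => (K i : Set F)) (d := d) e
      (fun i => by
        have h2 : 2 ≤ D i := hK i
        change e i < D i
        rcases lt_trichotomy i k' with h | h | h
        · rw [he1 i (Finset.mem_Iio.2 h)]; omega
        · rw [h, he2]; omega
        · rw [he3 i (Finset.mem_Ioi.2 h)]; omega)
      (by
        rw [hsplit, he2, Finset.sum_congr rfl he1, Finset.sum_congr rfl he3, hd]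
        simp [D])
    refine ((minDist_le hv hv₀).trans_eq hw).trans ?_
    change ∏ i, (D i - e i) ≤ _
    have hone : ∏ i ∈ Finset.Iio k', (D i - e i) = 1 := Finset.prod_eq_one fun i hi => by
      have h2 : 2 ≤ D i := hK i
      rw [he1 i hi]
      omega
    have htop : ∏ i ∈ Finset.Ioi k', (D i - e i) = ∏ i ∈ Finset.Ioi k', D i :=
      Finset.prod_congr rfl fun i hi => by rw [he3 i hi, Nat.sub_zero]
    rw [hsplit', hone, htop, he2, one_mul]
  obtain ⟨v, hv, hv₀, hw⟩ := exists_hammingNorm_eq_minDist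
    (exists_ne_zero_mem_quasiCode (fun i => (K i : Set F)) (fun i => ⟨0, (K i).zero_mem⟩) d δ s)
  obtain ⟨a, ha, had, has, hprod⟩ := exists_exponent_of_mem_quasiCode K hK d δ s hv hv₀
  change ∀ i, a i < D i at ha
  change a s ≤ D s - δ at has
  change δ ≤ D s at hδs
  change r = D s - δ + 1 at hrdef
  change D s ≤ D k' → D k' - ℓ ≤ D s → r ≤ D s - (D k' - ℓ) at hc2
  have hsD := hD hsk
  have hlt := mul_prod_lt_prod D (fun i => D i - a i) hD k' s (D k' - ℓ)
    (fun i => And.intro (Nat.sub_pos_of_lt (ha i)) (Nat.sub_le _ _)) hsk hDs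
    (by have := ha s; omega)
    (by
      have := ha s
      have := hc2 hsD
      intro h
      omega)
    (by
      have h1 : ∑ i, (D i - a i) + ∑ i, a i = ∑ i, D i := by
        rw [← Finset.sum_add_distrib]
        exact Finset.sum_congr rfl fun i _ => Nat.sub_add_cancel (ha i).le
      have h2 : ∑ i ∈ Finset.Iio k', (D i - 1) + k = ∑ i ∈ Finset.Iio k', D i := by
        have hk1 : k = ∑ i ∈ Finset.Iio k', 1 := by simp [hk']
        conv_lhs => rw [hk1]
        rw [← Finset.sum_add_distrib]
        exact Finset.sum_congr rfl fun i _ => Nat.sub_add_cancel (by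
          have h2 : 2 ≤ D i := hK i
          omega)
      have h3 := hsplit D
      have h4 : (k' : ℕ) = k := rfl
      change d = ∑ i ∈ Finset.Iio k', (D i - 1) + ℓ at hd
      omega)
  rw [hw, hmin] at hprod
  exact absurd (hlt.trans_le hprod) (not_lt.2 hupper)

end
end QACC
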